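/- Let seven distinct lines in Pic S₈ pairwise intersect in 1 (an A₆⁸(1)-polytope). Then there exist exactly seven 4-element subsets forming cornered A₃⁸(1)-polytopes, and the seven lines can be labeled l₁, …, l₇ so that these cornered subsets are {l₁,l₂,l₃,l₄}, {l₁,l₂,l₅,l₆}, {l₃,l₄,l₅,l₆}, {l₁,l₃,l₅,l₇}, {l₂,l₄,l₅,l₇}, {l₁,l₄,l₆,l₇} and {l₂,l₃,l₆,l₇}. -/

import Mathlib

/-!
Picard lattice of the degree 1 del Pezzo surface S₈:
Pic S₈ = ℤh ⊕ ℤe₁ ⊕ ⋯ ⊕ ℤe₈ ≅ ℤ⁹, with intersection pairing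
h·h = 1, h·eᵢ = 0, eᵢ·eⱼ = −δᵢⱼ, and canonical class K = −3h + e₁ + ⋯ + e₈.
-/

namespace DelPezzo

/-- The Picard lattice `Pic S₈ ≅ ℤ⁹`; coordinate `0` is the `h`-coordinate and
coordinates `1,…,8` are the `e₁,…,e₈`-coordinates. -/
abbrev Pic : Type := Fin 9 → ℤ

/-- The intersection pairing on `Pic S₈` (signature `(1,-8)`). -/
def inter (x y : Pic) : ℤ := x 0 * y 0 - ∑ i : Fin 8, x i.succ * y i.succ

/-- The canonical class `K = -3h + e₁ + ⋯ + e₈`. -/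
def K : Pic := fun i => if i = 0 then -3 else 1

/-- A line: a class `l` with `l·l = -1` and `l·K = -1`. -/
def IsLine (l : Pic) : Prop := inter l l = -1 ∧ inter l K = -1

/-- A finite set of lines is cornered if some line has intersection `0` with all of them. -/
def IsCornered (T : Finset Pic) : Prop := ∃ m : Pic, IsLine m ∧ ∀ x ∈ T, inter m x = 0

open Matrix

theorem inter_comm (x y : Pic) : inter x y = inter y x := by
  simp only [inter, mul_comm]

theorem inter_add_left (x y z : Pic) : inter (x + y) z = inter x z + inter y z := by
  simp only [inter, Pi.add_apply, add_mul, Finset.sum_add_distrib]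
  ring

theorem inter_smul_left (a : ℤ) (x y : Pic) : inter (a • x) y = a * inter x y := by
  simp only [inter, Pi.smul_apply, smul_eq_mul, mul_assoc, ← Finset.mul_sum]
  ring

theorem inter_add_right (x y z : Pic) : inter x (y + z) = inter x y + inter x z := by
  rw [inter_comm, inter_add_left, inter_comm y, inter_comm z]

theorem inter_smul_right (a : ℤ) (x y : Pic) : inter x (a • y) = a * inter x y := by
  rw [inter_comm, inter_smul_left, inter_comm]

theorem inter_sub_left (x y z : Pic) : inter (x - y) z = inter x z - inter y z := by
  rw [eq_sub_iff_add_eq, ← inter_add_left, sub_add_cancel]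

theorem inter_sub_right (x y z : Pic) : inter x (y - z) = inter x y - inter x z := by
  rw [inter_comm, inter_sub_left, inter_comm y, inter_comm z]

theorem inter_sum_left {ι : Type*} (U : Finset ι) (r : ι → Pic) (y : Pic) :
    inter (∑ i ∈ U, r i) y = ∑ i ∈ U, inter (r i) y := by
  classical
  induction U using Finset.induction_on with
  | empty => simp [inter]
  | insert i U hi ih => rw [Finset.sum_insert hi, Finset.sum_insert hi, inter_add_left, ih]

theorem inter_K_K : inter K K = 1 := by decide

/-- `K` is a characteristic vector of the Picard lattice. -/
theorem even_inter_self_add_inter_K (z : Pic) : Even (inter z z + inter z K) := by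
  have h (a : ℤ) : Even (a * a + a) := by simpa [mul_add] using Int.even_mul_succ_self a
  have h0 : inter z z + inter z K =
      (z 0 * z 0 + z 0) - 4 * z 0 - ∑ i : Fin 8, (z i.succ * z i.succ + z i.succ) := by
    simp [inter, K, Finset.sum_add_distrib, Fin.succ_ne_zero]
    ring
  rw [h0]
  exact ((h _).sub ((by decide : Even (4 : ℤ)).mul_right _)).sub
    (Finset.even_sum _ fun i _ => h _)

/-- The intersection pairing is definite on the orthogonal complement of `K`. -/
theorem eq_zero_of_inter_self_eq_zero {w : Pic} (hK : inter w K = 0) (hw : inter w w = 0) :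
    w = 0 := by
  have hcs := sq_sum_le_card_mul_sum_sq (s := Finset.univ) (f := fun i : Fin 8 => w i.succ)
  simp only [inter, K, Fin.succ_ne_zero, if_true, if_false, mul_one] at hK
  simp only [inter, ← sq] at hw
  simp only [Finset.card_univ, Fintype.card_fin] at hcs
  push_cast at hcs
  have hsum : ∑ i : Fin 8, w i.succ = -3 * w 0 := by linarith
  rw [hsum] at hcs
  have h0 : w 0 ^ 2 = 0 := by nlinarith [sq_nonneg (w 0)]
  have hs : ∑ i : Fin 8, w i.succ ^ 2 = 0 := by linarith
  rw [Finset.sum_eq_zero_iff_of_nonneg fun i _ => sq_nonneg _] at hs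
  funext i
  refine Fin.cases ?_ (fun i => ?_) i
  · exact pow_eq_zero_iff two_ne_zero |>.1 h0
  · exact pow_eq_zero_iff two_ne_zero |>.1 (hs i (Finset.mem_univ i))

section OrthogonalRoots

theorem inter_sum_K {ι : Type*} {r : ι → Pic} (hK : ∀ i, inter (r i) K = 0) (U : Finset ι) :
    inter (∑ i ∈ U, r i) K = 0 := by
  simp [inter_sum_left, hK]

variable {ι : Type*} [DecidableEq ι] {r : ι → Pic}

theorem inter_sum_root (hr : ∀ i j, inter (r i) (r j) = if i = j then -2 else 0)
    (U : Finset ι) (j : ι) : inter (∑ i ∈ U, r i) (r j) = if j ∈ U then -2 else 0 := by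
  simp [inter_sum_left, hr]

theorem inter_sum_self (hr : ∀ i j, inter (r i) (r j) = if i = j then -2 else 0)
    (U : Finset ι) : inter (∑ i ∈ U, r i) (∑ i ∈ U, r i) = -2 * U.card := by
  rw [inter_sum_left, Finset.sum_congr rfl fun i hi =>
    show _ = (-2 : ℤ) by rw [inter_comm, inter_sum_root hr, if_pos hi]]
  simp [mul_comm]

theorem four_dvd_card_of_sum_eq_two_smul
    (hr : ∀ i j, inter (r i) (r j) = if i = j then -2 else 0) (hK : ∀ i, inter (r i) K = 0)
    {U : Finset ι} {z : Pic} (hz : ∑ i ∈ U, r i = (2 : ℤ) • z) : 4 ∣ U.card := by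
  have h1 := inter_sum_self hr U
  have h2 := inter_sum_K hK U
  have h3 := even_inter_self_add_inter_K z
  rw [hz] at h1 h2
  simp only [inter_smul_left, inter_smul_right] at h1 h2
  obtain ⟨k, hk⟩ := h3
  omega

/-- A set of four lines `r i - K` attached to orthogonal roots `r i` is cornered exactly when
half the sum of the roots is integral. -/
theorem isCornered_iff_exists_sum_eq_two_smul
    (hr : ∀ i j, inter (r i) (r j) = if i = j then -2 else 0) (hK : ∀ i, inter (r i) K = 0)
    {U : Finset ι} (hU : U.card = 4) :
    IsCornered (U.image fun i => r i - K) ↔ ∃ z : Pic, ∑ i ∈ U, r i = (2 : ℤ) • z := by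
  have hs := inter_sum_self hr U
  have hsK := inter_sum_K hK U
  rw [hU] at hs
  constructor
  · rintro ⟨m, ⟨hm, hmK⟩, h⟩
    refine ⟨m + K, ?_⟩
    have hrm (i) (hi : i ∈ U) : inter (r i) m = -1 := by
      have := h _ (Finset.mem_image_of_mem _ hi)
      rw [inter_sub_right, inter_comm m (r i)] at this
      linarith
    have hsm : inter (∑ i ∈ U, r i) m = -4 := by
      rw [inter_sum_left, Finset.sum_congr rfl hrm]
      simp [hU]
    rw [← sub_eq_zero]
    apply eq_zero_of_inter_self_eq_zero
    · simp only [inter_sub_left, inter_smul_left, inter_add_left, hsK, hmK, inter_K_K]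
      norm_num
    · simp only [inter_sub_left, inter_sub_right, inter_smul_left, inter_smul_right,
        inter_add_left, inter_add_right, inter_comm _ (∑ i ∈ U, r i), inter_comm K m,
        hs, hsK, hsm, hm, hmK, inter_K_K]
      norm_num
  · rintro ⟨z, hz⟩
    have hzr (i) (hi : i ∈ U) : inter z (r i) = -1 := by
      have := inter_sum_root hr U i
      rw [hz, inter_smul_left, if_pos hi] at this
      linarith
    rw [hz] at hs hsK
    simp only [inter_smul_left, inter_smul_right] at hs hsK
    have hzK : inter z K = 0 := by linarith
    refine ⟨z - K, ⟨?_, ?_⟩, ?_⟩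
    · simp only [inter_sub_left, inter_sub_right, inter_comm K z, inter_K_K, hzK]
      push_cast at hs
      linarith
    · rw [inter_sub_left, hzK, inter_K_K]
      norm_num
    · simp only [Finset.forall_mem_image]
      intro i hi
      simp only [inter_sub_left, inter_sub_right, inter_K_K, hzK, hzr i hi, inter_comm K (r i),
        hK i]
      norm_num

end OrthogonalRoots

section Code

variable {ι : Type*}

/-- The `ZMod 2`-valued indicator vector of a finite set. -/
def indicator [DecidableEq ι] (U : Finset ι) (i : ι) : ZMod 2 := if i ∈ U then 1 else 0

/-- The matrix whose columns are the reductions modulo 2 of the vectors `r i`. -/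
def modTwoMatrix (r : ι → Pic) : Matrix (Fin 9) ι (ZMod 2) := fun k i => r i k

/-- The binary code of relations modulo 2 between the vectors `r i`. -/
noncomputable def relationCode [Fintype ι] (r : ι → Pic) : Submodule (ZMod 2) (ι → ZMod 2) :=
  LinearMap.ker (modTwoMatrix r).mulVecLin

theorem indicator_mem_relationCode [Fintype ι] [DecidableEq ι] (r : ι → Pic) (U : Finset ι) :
    indicator U ∈ relationCode r ↔ ∃ z : Pic, ∑ i ∈ U, r i = (2 : ℤ) • z := by
  have h : indicator U ∈ relationCode r ↔ ∀ k, (2 : ℤ) ∣ (∑ i ∈ U, r i) k := by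
    rw [relationCode, LinearMap.mem_ker, funext_iff]
    refine forall_congr' fun k => ?_
    have := ZMod.intCast_zmod_eq_zero_iff_dvd ((∑ i ∈ U, r i) k) 2
    refine Iff.trans ?_ this
    simp [Matrix.mulVec, dotProduct, indicator, modTwoMatrix]
  rw [h]
  constructor
  · intro h
    choose z hz using h
    exact ⟨z, funext hz⟩
  · rintro ⟨z, hz⟩ k
    exact ⟨z k, congrFun hz k⟩

theorem indicator_support [Fintype ι] [DecidableEq ι] (c : ι → ZMod 2) :
    indicator {i | c i ≠ 0} = c := by
  have h : ∀ a : ZMod 2, (if a ≠ 0 then 1 else 0) = a := by decide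
  funext i
  simpa [indicator] using h (c i)

theorem four_dvd_hammingNorm_of_mem_relationCode [Fintype ι] [DecidableEq ι] {r : ι → Pic}
    (hr : ∀ i j, inter (r i) (r j) = if i = j then -2 else 0) (hK : ∀ i, inter (r i) K = 0)
    {c : ι → ZMod 2} (hc : c ∈ relationCode r) : 4 ∣ hammingNorm c := by
  rw [← indicator_support c, indicator_mem_relationCode] at hc
  obtain ⟨z, hz⟩ := hc
  exact four_dvd_card_of_sum_eq_two_smul hr hK hz

theorem inter_cast_zmod_two (x y : Pic) :
    (inter x y : ZMod 2) = ∑ k, (x k : ZMod 2) * (y k : ZMod 2) := by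
  rw [Fin.sum_univ_succ, inter]
  push_cast
  exact CharTwo.sub_eq_add _ _

theorem three_le_finrank_relationCode {r : Fin 7 → Pic}
    (hr : ∀ i j, inter (r i) (r j) = if i = j then -2 else 0) :
    3 ≤ Module.finrank (ZMod 2) (relationCode r) := by
  have h0 : (modTwoMatrix r)ᵀ * modTwoMatrix r = 0 := by
    ext i j
    rw [Matrix.mul_apply, Matrix.zero_apply]
    refine (inter_cast_zmod_two (r i) (r j)).symm.trans ?_
    rw [hr]
    split_ifs <;> decide
  have h1 := Matrix.rank_add_rank_le_card_of_mul_eq_zero h0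
  have h2 := (modTwoMatrix r).mulVecLin.finrank_range_add_finrank_ker
  rw [Matrix.rank_transpose] at h1
  simp only [Matrix.rank, Fintype.card_fin, Module.finrank_fintype_fun_eq_card] at h1 h2
  change 3 ≤ Module.finrank (ZMod 2) (LinearMap.ker (modTwoMatrix r).mulVecLin)
  omega

/-- A linear map into words all of whose nonzero values have weight 4 has every nonzero functional
among its coordinates. -/
theorem exists_coordinate_eq_dotProduct [Fintype ι]
    (f : (Fin 3 → ZMod 2) →ₗ[ZMod 2] ι → ZMod 2)
    (hf : ∀ v, v ≠ 0 → hammingNorm (f v) = 4) {q : Fin 3 → ZMod 2} (hq : q ≠ 0) :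
    ∃ i, ∀ v, f v i = v ⬝ᵥ q := by
  set p : ι → Fin 3 → ZMod 2 := fun i j => f (Pi.single j 1) i with hp
  have hfp (v) (i) : f v i = v ⬝ᵥ p i := by
    conv_lhs => rw [pi_eq_sum_univ' v]
    simp [hp, dotProduct]
  suffices h : ∃ i, p i = q by
    obtain ⟨i, rfl⟩ := h
    exact ⟨i, fun v => hfp v i⟩
  by_contra! h
  have key : ∀ p q : Fin 3 → ZMod 2, q ≠ 0 → p ≠ q →
      ∑ v ∈ Finset.univ.erase 0, (if v ⬝ᵥ q ≠ 0 then (1 : ℤ) else -1) *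
        (if v ⬝ᵥ p ≠ 0 then 1 else 0) = 0 := by decide +kernel
  have count : ∀ q : Fin 3 → ZMod 2, q ≠ 0 →
      ∑ v ∈ Finset.univ.erase 0, (if v ⬝ᵥ q ≠ 0 then (1 : ℤ) else -1) * 4 = 4 := by
    decide +kernel
  have hsum := Finset.sum_eq_zero fun i (_ : i ∈ Finset.univ) => key (p i) q hq (h i)
  rw [Finset.sum_comm] at hsum
  have hcount := count q hq
  refine four_ne_zero (hcount.symm.trans (Eq.trans (Finset.sum_congr rfl fun v hv => ?_) hsum))
  rw [← Finset.mul_sum, Finset.sum_boole]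
  have hw := hf v (Finset.ne_of_mem_erase hv)
  simp only [hammingNorm, hfp] at hw
  rw [hw, Nat.cast_ofNat]

theorem exists_linearMap_hammingNorm_eq_four (C : Submodule (ZMod 2) (Fin 7 → ZMod 2))
    (hrank : 3 ≤ Module.finrank (ZMod 2) C) (hC : ∀ c ∈ C, 4 ∣ hammingNorm c) :
    ∃ f : (Fin 3 → ZMod 2) →ₗ[ZMod 2] Fin 7 → ZMod 2,
      (∀ v, f v ∈ C) ∧ ∀ v, v ≠ 0 → hammingNorm (f v) = 4 := by
  obtain ⟨b, hb⟩ := exists_linearIndependent_of_le_finrank hrank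
  have hinj : Function.Injective (C.subtype ∘ₗ Fintype.linearCombination (ZMod 2) b) :=
    C.subtype_injective.comp hb.fintypeLinearCombination_injective
  refine ⟨C.subtype ∘ₗ Fintype.linearCombination (ZMod 2) b, fun v => Subtype.prop _, ?_⟩
  intro v hv
  have hmem : (C.subtype ∘ₗ Fintype.linearCombination (ZMod 2) b) v ∈ C := Subtype.prop _
  have hpos : 0 < hammingNorm ((C.subtype ∘ₗ Fintype.linearCombination (ZMod 2) b) v) := by
    rw [hammingNorm_pos_iff]
    exact fun h => hv ((map_eq_zero_iff _ hinj).1 h)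
  have hle := hammingNorm_le_card_fintype
    (x := (C.subtype ∘ₗ Fintype.linearCombination (ZMod 2) b) v)
  have hdvd := hC _ hmem
  rw [Fintype.card_fin] at hle
  omega

/-- The columns of a generator matrix of the binary simplex code of length 7. -/
def simplexColumn : Fin 7 → Fin 3 → ZMod 2 :=
  ![![1, 1, 1], ![1, 1, 0], ![1, 0, 1], ![1, 0, 0], ![0, 1, 1], ![0, 1, 0], ![0, 0, 1]]

/-- The supports of the nonzero words of the simplex code. -/
def simplexSupports : Finset (Finset (Fin 7)) :=
  {{0, 1, 2, 3}, {0, 1, 4, 5}, {2, 3, 4, 5}, {0, 2, 4, 6}, {1, 3, 4, 6}, {0, 3, 5, 6},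
    {1, 2, 5, 6}}

theorem exists_indicator_eq_of_mem_simplexSupports : ∀ U ∈ simplexSupports,
    ∃ v : Fin 3 → ZMod 2, ∀ i, indicator U i = v ⬝ᵥ simplexColumn i := by
  decide +kernel

theorem mem_simplexSupports_of_four_dvd : ∀ U : Finset (Fin 7), U.card = 4 →
    (∀ v : Fin 3 → ZMod 2, 4 ∣ hammingNorm fun i => indicator U i + v ⬝ᵥ simplexColumn i) →
    U ∈ simplexSupports := by
  decide +kernel

/-- A doubly even binary code of length 7 and dimension at least 3 is the simplex code, up to a
permutation of the coordinates. -/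
theorem exists_perm_mem_iff_mem_simplexSupports (C : Submodule (ZMod 2) (Fin 7 → ZMod 2))
    (hrank : 3 ≤ Module.finrank (ZMod 2) C) (hC : ∀ c ∈ C, 4 ∣ hammingNorm c) :
    ∃ σ : Equiv.Perm (Fin 7), ∀ U : Finset (Fin 7), U.card = 4 →
      (indicator (U.image σ) ∈ C ↔ U ∈ simplexSupports) := by
  obtain ⟨f, hfC, hf⟩ := exists_linearMap_hammingNorm_eq_four C hrank hC
  have hne : ∀ i, simplexColumn i ≠ 0 := by decide
  choose s hs using fun i => exists_coordinate_eq_dotProduct f hf (hne i)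
  have hcol : Function.Injective simplexColumn := by decide
  have hinj : Function.Injective s := fun i j hij =>
    hcol (dotProduct_eq _ _ fun v => by
      rw [dotProduct_comm, ← hs, hij, hs, dotProduct_comm])
  let σ : Equiv.Perm (Fin 7) := Equiv.ofBijective s (Finite.injective_iff_bijective.1 hinj)
  have hσ (v) (i) : f v (σ i) = v ⬝ᵥ simplexColumn i := hs i v
  have hind (U : Finset (Fin 7)) (i) : indicator (U.image σ) (σ i) = indicator U i := by
    simp [indicator]
  refine ⟨σ, fun U hU => ⟨fun h => mem_simplexSupports_of_four_dvd U hU fun v => ?_, fun h => ?_⟩⟩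
  · have h4 := hC _ (C.add_mem h (hfC v))
    have hnorm : hammingNorm (indicator (U.image σ) + f v) =
        hammingNorm fun i => indicator U i + v ⬝ᵥ simplexColumn i := by
      rw [hammingNorm, hammingNorm]
      refine (Finset.card_bijective σ σ.bijective fun i => ?_).symm
      simp [hσ, hind]
    rwa [hnorm] at h4
  · obtain ⟨v, hv⟩ := exists_indicator_eq_of_mem_simplexSupports U h
    have : indicator (U.image σ) = f v := by
      funext j
      obtain ⟨i, rfl⟩ := σ.surjective j
      rw [hind, hv, hσ]
    exact this ▸ hfC v

end Code

theorem seven_cornered_subsets_of_seven (S : Finset Pic) (hcard : S.card = 7)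
    (hline : ∀ x ∈ S, IsLine x)
    (hint : ∀ x ∈ S, ∀ y ∈ S, x ≠ y → inter x y = 1) :
    ∃ l : Fin 7 → Pic, Function.Injective l ∧ Finset.image l Finset.univ = S ∧
      ∀ T : Finset Pic, T ⊆ S → T.card = 4 →
        (IsCornered T ↔
          T = {l 0, l 1, l 2, l 3} ∨ T = {l 0, l 1, l 4, l 5} ∨
          T = {l 2, l 3, l 4, l 5} ∨ T = {l 0, l 2, l 4, l 6} ∨
          T = {l 1, l 3, l 4, l 6} ∨ T = {l 0, l 3, l 5, l 6} ∨
          T = {l 1, l 2, l 5, l 6}) := by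
  let e : Fin 7 ≃ S := (S.equivFinOfCardEq hcard).symm
  let r : Fin 7 → Pic := fun i => e i + K
  have hrK (i) : inter (r i) K = 0 := by
    rw [inter_add_left, (hline _ (e i).2).2, inter_K_K]
    norm_num
  have hr (i j) : inter (r i) (r j) = if i = j then -2 else 0 := by
    have hij : inter (e i) (e j) = if i = j then -1 else 1 := by
      split_ifs with h
      · rw [h]
        exact (hline _ (e j).2).1
      · exact hint _ (e i).2 _ (e j).2 fun h' => h (e.injective (Subtype.ext h'))
    have hi := (hline _ (e i).2).2
    have hj := (hline _ (e j).2).2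
    simp only [r, inter_add_left, inter_add_right, inter_comm K (e j), hij, hi, hj, inter_K_K]
    split_ifs <;> norm_num
  obtain ⟨σ, hσ⟩ := exists_perm_mem_iff_mem_simplexSupports (relationCode r)
    (three_le_finrank_relationCode hr) fun c => four_dvd_hammingNorm_of_mem_relationCode hr hrK
  let l : Fin 7 → Pic := fun i => e (σ i)
  have hl : Function.Injective l :=
    Subtype.val_injective.comp (e.injective.comp σ.injective)
  have himage : Finset.image l Finset.univ = S := by
    refine Finset.eq_of_subset_of_card_le ?_ ?_
    · exact Finset.image_subset_iff.2 fun i _ => (e (σ i)).2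
    · rw [Finset.card_image_of_injective _ hl, hcard, Finset.card_univ, Fintype.card_fin]
  refine ⟨l, hl, himage, fun T hT hT4 => ?_⟩
  rw [← himage] at hT
  obtain ⟨U, -, rfl⟩ := Finset.subset_image_iff.1 hT
  rw [Finset.card_image_of_injective _ hl] at hT4
  have hcorner : IsCornered (U.image l) ↔ U ∈ simplexSupports := by
    rw [← hσ U hT4, indicator_mem_relationCode, ← isCornered_iff_exists_sum_eq_two_smul hr hrK
      (by rw [Finset.card_image_of_injective _ σ.injective, hT4]), Finset.image_image]
    simp [r, l, Function.comp_def]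
  have himg (V : Finset (Fin 7)) : U = V ↔ U.image l = V.image l :=
    (Finset.image_injective hl).eq_iff.symm
  rw [hcorner]
  simp only [simplexSupports, Finset.mem_insert, Finset.mem_singleton, himg,
    Finset.image_insert, Finset.image_singleton]

end DelPezzo
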